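/- The achievable rate expressions of the block-by-block backward decoding scheme and of the B-blocks-by-B-blocks backward decoding scheme coincide: min over k ∈ {2,…,M+2} of F_k(D_k) equals min over k ∈ {2,…,M+2} of the maximum over T_k ⊆ N∖M of F_k(T_k), where for each k, D_k is the unique largest subset of N∖M that is self-decodable at node π(k). -/

import Mathlib

open scoped BigOperators

set_option synthInstance.maxHeartbeats 1000000
set_option synthInstance.maxSize 1024
set_option maxHeartbeats 1000000

/-- Shannon entropy (natural log) of a random variable `X` on a finite sample
space `Ω` with probability mass function `μ`. -/
noncomputable def entropy {Ω α : Type*} [Fintype Ω] [Fintype α] [DecidableEq α]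
    (μ : Ω → ℝ) (X : Ω → α) : ℝ :=
  ∑ a : α, Real.negMulLog (∑ ω ∈ Finset.univ.filter (fun ω => X ω = a), μ ω)

/-- Conditional mutual information `I(X;Y|Z)` for random variables on a finite
sample space with pmf `μ`. -/
noncomputable def condMI {Ω α β γ : Type*} [Fintype Ω]
    [Fintype α] [DecidableEq α] [Fintype β] [DecidableEq β] [Fintype γ] [DecidableEq γ]
    (μ : Ω → ℝ) (X : Ω → α) (Y : Ω → β) (Z : Ω → γ) : ℝ :=
  entropy μ (fun ω => (X ω, Z ω)) + entropy μ (fun ω => (Y ω, Z ω))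
    - entropy μ (fun ω => (X ω, Y ω, Z ω)) - entropy μ Z

/-- Sample space for the unified D-F/C-F multiple-relay framework: a value of
`(q, x₀, (xᵢ)ᵢ, (yᵢ)ᵢ, y_{n+1}, (ŷᵢ)ᵢ)`. -/
abbrev DFOmega {n : ℕ} (QA X0A : Type) (XA YA : Fin n → Type) (YdA : Type)
    (YhA : Fin n → Type) : Type :=
  QA × X0A × (∀ i, XA i) × (∀ i, YA i) × YdA × (∀ i, YhA i)

section DF

variable {n Mc : ℕ} {QA X0A YdA : Type} {XA YA YhA : Fin n → Type}

/-- The time-sharing variable `Q`. -/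
def rvQ : DFOmega QA X0A XA YA YdA YhA → QA := fun ω => ω.1

/-- The source input `X₀`. -/
def rvX0 : DFOmega QA X0A XA YA YdA YhA → X0A := fun ω => ω.2.1

/-- The tuple of relay inputs `X_S = (Xᵢ)_{i∈S}`. -/
def rvXS (S : Finset (Fin n)) : DFOmega QA X0A XA YA YdA YhA → (∀ i : S, XA i) :=
  fun ω i => ω.2.2.1 i

/-- The tuple of relay outputs `Y_S = (Yᵢ)_{i∈S}`. -/
def rvYS (S : Finset (Fin n)) : DFOmega QA X0A XA YA YdA YhA → (∀ i : S, YA i) :=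
  fun ω i => ω.2.2.2.1 i

/-- The destination output `Y_{n+1}`. -/
def rvYd : DFOmega QA X0A XA YA YdA YhA → YdA := fun ω => ω.2.2.2.2.1

/-- The tuple of compressions `Ŷ_S = (Ŷᵢ)_{i∈S}`. -/
def rvYhS (S : Finset (Fin n)) : DFOmega QA X0A XA YA YdA YhA → (∀ i : S, YhA i) :=
  fun ω i => ω.2.2.2.2.2 i

/-- The joint pmf
`p(q)·p(x₀|q)·p(x_M|x₀,q)·∏_{i∈N∖M} p(xᵢ|q) · p(y₁,…,y_{n+1}|x₀,…,x_n) ·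
∏ p(ŷᵢ|yᵢ,xᵢ,q)`. -/
noncomputable def muDF (ℳ : Finset (Fin n)) (pQ : QA → ℝ) (p0 : QA → X0A → ℝ)
    (pM : QA → X0A → (∀ i : ℳ, XA i) → ℝ) (pC : ∀ i : Fin n, QA → XA i → ℝ)
    (W : X0A → (∀ i, XA i) → ((∀ i, YA i) × YdA) → ℝ)
    (κ : ∀ i : Fin n, QA → YA i → XA i → YhA i → ℝ) :
    DFOmega QA X0A XA YA YdA YhA → ℝ :=
  fun ω => pQ ω.1 * p0 ω.1 ω.2.1 * pM ω.1 ω.2.1 (fun i => ω.2.2.1 i)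
    * (∏ i ∈ ℳᶜ, pC i ω.1 (ω.2.2.1 i))
    * W ω.2.1 ω.2.2.1 (ω.2.2.2.1, ω.2.2.2.2.1)
    * ∏ i, κ i ω.1 (ω.2.2.2.1 i) (ω.2.2.1 i) (ω.2.2.2.2.2 i)

/-- The set of relays upstream of node `π(k)` in the D-F route, i.e. the relays
`π(2:k-1)` of the paper: with `σ` enumerating the D-F relays in route order and
`k : Fin (Mc+1)` standing for the paper's index `k+2 ∈ {2,…,M+2}`, this is
`{σ j : j < k}`. -/
def upSet (σ : Fin Mc → Fin n) (k : Fin (Mc + 1)) : Finset (Fin n) :=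
  (Finset.univ.filter (fun j : Fin Mc => (j : ℕ) < (k : ℕ))).image σ

/-- The set of relays `π(k:M+1)` of the paper, namely the D-F relays downstream
of (and including) node `π(k)`: `{σ j : k ≤ j}`. -/
def downSet (σ : Fin Mc → Fin n) (k : Fin (Mc + 1)) : Finset (Fin n) :=
  (Finset.univ.filter (fun j : Fin Mc => (k : ℕ) ≤ (j : ℕ))).image σ

/-- The alphabet of the channel output `Y_{π(k)}` observed at node `π(k)`: a relay
output for `k < Mc`, and the destination output for `k = Mc` (paper `k = M+2`). -/
def YkType (σ : Fin Mc → Fin n) (YA : Fin n → Type) (YdA : Type)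
    (k : Fin (Mc + 1)) : Type :=
  if h : (k : ℕ) < Mc then YA (σ ⟨(k : ℕ), h⟩) else YdA

instance YkType.instFintype (σ : Fin Mc → Fin n) [∀ i, Fintype (YA i)] [Fintype YdA]
    (k : Fin (Mc + 1)) : Fintype (YkType σ YA YdA k) := by
  unfold YkType; split <;> infer_instance

instance YkType.instDecidableEq (σ : Fin Mc → Fin n) [∀ i, DecidableEq (YA i)]
    [DecidableEq YdA] (k : Fin (Mc + 1)) : DecidableEq (YkType σ YA YdA k) := by
  unfold YkType; split <;> infer_instance

/-- The channel output `Y_{π(k)}` observed at node `π(k)`. -/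
def rvYk (σ : Fin Mc → Fin n) (k : Fin (Mc + 1))
    (ω : DFOmega QA X0A XA YA YdA YhA) : YkType σ YA YdA k :=
  if h : (k : ℕ) < Mc then
    cast (by simp [YkType, h]) (ω.2.2.2.1 (σ ⟨(k : ℕ), h⟩))
  else
    cast (by simp [YkType, h]) ω.2.2.2.2.1

variable [Fintype QA] [DecidableEq QA] [Fintype X0A] [DecidableEq X0A]
  [Fintype YdA] [DecidableEq YdA]
  [∀ i, Fintype (XA i)] [∀ i, DecidableEq (XA i)]
  [∀ i, Fintype (YA i)] [∀ i, DecidableEq (YA i)]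
  [∀ i, Fintype (YhA i)] [∀ i, DecidableEq (YhA i)]

/-- `F_k(T) = min_{S ⊆ T} [ I(X_{π(1:k-1)}, X_S; Ŷ_{T∖S}, Y_{π(k)} | X_{T∖S}, X_{π(k:M+1)}, Q)`
`− I(Y_S; Ŷ_S | X_{π(1:M+1)}, X_T, Y_{π(k)}, Ŷ_{T∖S}, Q) ]`, where `π(1:k-1)`
consists of the source `0` together with `upSet σ k`, `π(k:M+1) = downSet σ k`,
and `π(1:M+1)` consists of the source together with all D-F relays `ℳ`. -/
noncomputable def Fk (ℳ : Finset (Fin n)) (σ : Fin Mc → Fin n)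
    (μ : DFOmega QA X0A XA YA YdA YhA → ℝ) (k : Fin (Mc + 1))
    (T : Finset (Fin n)) : ℝ :=
  T.powerset.inf' (Finset.powerset_nonempty T) fun S =>
    condMI μ (fun ω => ((rvX0 ω, rvXS (upSet σ k) ω), rvXS S ω))
      (fun ω => (rvYhS (T \ S) ω, rvYk σ k ω))
      (fun ω => (rvXS (T \ S) ω, rvXS (downSet σ k) ω, rvQ ω))
    - condMI μ (rvYS S) (rvYhS S)
      (fun ω => ((rvX0 ω, rvXS ℳ ω), rvXS T ω, rvYk σ k ω, rvYhS (T \ S) ω, rvQ ω))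

/-- `D ⊆ N∖M` is self-decodable at node `π(k)` if for every nonempty `S ⊆ D`,
`I(X_S; Ŷ_{D∖S}, Y_{π(k)} | X_{π(1:M+1)}, X_{D∖S}, Q)`
`− I(Y_S; Ŷ_S | X_{π(1:M+1)}, X_D, Y_{π(k)}, Ŷ_{D∖S}, Q) > 0`. -/
def SelfDecodable (ℳ : Finset (Fin n)) (σ : Fin Mc → Fin n)
    (μ : DFOmega QA X0A XA YA YdA YhA → ℝ) (k : Fin (Mc + 1))
    (D : Finset (Fin n)) : Prop :=
  ∀ S ⊆ D, S.Nonempty →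
    0 < condMI μ (rvXS S) (fun ω => (rvYhS (D \ S) ω, rvYk σ k ω))
          (fun ω => ((rvX0 ω, rvXS ℳ ω), rvXS (D \ S) ω, rvQ ω))
      - condMI μ (rvYS S) (rvYhS S)
          (fun ω => ((rvX0 ω, rvXS ℳ ω), rvXS D ω, rvYk σ k ω, rvYhS (D \ S) ω, rvQ ω))

end DF

set_option linter.unusedSectionVars false

section EntropyFacts

variable {Ω α β γ δ : Type*} [Fintype Ω] [Fintype α] [DecidableEq α] [Fintype β] [DecidableEq β]
  [Fintype γ] [DecidableEq γ] [Fintype δ] [DecidableEq δ]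

/-- The probability that `X` takes the value `a`. -/
def fiberMass (μ : Ω → ℝ) (X : Ω → α) (a : α) : ℝ :=
  ∑ ω ∈ Finset.univ.filter (fun ω => X ω = a), μ ω

theorem fiberMass_nonneg {μ : Ω → ℝ} (hμ : ∀ ω, 0 ≤ μ ω) (X : Ω → α) (a : α) :
    0 ≤ fiberMass μ X a :=
  Finset.sum_nonneg fun ω _ => hμ ω

theorem fiberMass_pos {μ : Ω → ℝ} (hμ : ∀ ω, 0 ≤ μ ω) (X : Ω → α) {ω : Ω} (h : 0 < μ ω) :
    0 < fiberMass μ X (X ω) :=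
  h.trans_le (Finset.single_le_sum (f := μ) (fun ω _ => hμ ω) (by simp))

theorem sum_mul_comp_eq_sum_fiberMass (μ : Ω → ℝ) (X : Ω → α) (f : α → ℝ) :
    ∑ ω, μ ω * f (X ω) = ∑ a, fiberMass μ X a * f a := by
  rw [← Finset.sum_fiberwise Finset.univ X]
  refine Finset.sum_congr rfl fun a _ => ?_
  rw [fiberMass, Finset.sum_mul]
  refine Finset.sum_congr rfl fun ω hω => ?_
  rw [(Finset.mem_filter.1 hω).2]

theorem sum_fiberMass (μ : Ω → ℝ) (X : Ω → α) : ∑ a, fiberMass μ X a = ∑ ω, μ ω :=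
  Finset.sum_fiberwise Finset.univ X μ

theorem sum_fiberMass_fst (μ : Ω → ℝ) (X : Ω → α) (Z : Ω → γ) (z : γ) :
    ∑ a, fiberMass μ (fun ω => (X ω, Z ω)) (a, z) = fiberMass μ Z z := by
  unfold fiberMass
  rw [← Finset.sum_fiberwise (Finset.univ.filter fun ω => Z ω = z) X]
  refine Finset.sum_congr rfl fun a _ => ?_
  rw [Finset.filter_filter]
  refine Finset.sum_congr ?_ fun _ _ => rfl
  ext ω
  simp [and_comm]

theorem entropy_eq_sum_log (μ : Ω → ℝ) (X : Ω → α) :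
    entropy μ X = ∑ ω, μ ω * -Real.log (fiberMass μ X (X ω)) := by
  rw [sum_mul_comp_eq_sum_fiberMass μ X fun a => -Real.log (fiberMass μ X a)]
  simp [entropy, Real.negMulLog, fiberMass]

/-- Entropy depends only on the partition of the sample space into level sets. -/
theorem entropy_congr (μ : Ω → ℝ) {X : Ω → α} {Y : Ω → β}
    (h : ∀ ω ω', X ω = X ω' ↔ Y ω = Y ω') : entropy μ X = entropy μ Y := by
  simp only [entropy_eq_sum_log, fiberMass, h]

theorem entropy_comp_of_map {Ω' : Type*} [Fintype Ω'] {μ : Ω → ℝ} {ν : Ω' → ℝ} (r : Ω → Ω')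
    (h : ∀ f : Ω' → ℝ, ∑ ω, μ ω * f (r ω) = ∑ ω, ν ω * f ω) (Z : Ω' → α) :
    entropy μ (fun ω => Z (r ω)) = entropy ν Z := by
  unfold entropy
  refine Finset.sum_congr rfl fun a _ => congrArg _ ?_
  have := h fun ω => if Z ω = a then 1 else 0
  simpa [Finset.sum_filter] using this

theorem condMI_nonneg {μ : Ω → ℝ} (hμ : ∀ ω, 0 ≤ μ ω) (X : Ω → α) (Y : Ω → β) (Z : Ω → γ) :
    0 ≤ condMI μ X Y Z := by
  set pxz := fiberMass μ fun ω => (X ω, Z ω)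
  set pyz := fiberMass μ fun ω => (Y ω, Z ω)
  set pxyz := fiberMass μ fun ω => (X ω, Y ω, Z ω)
  set pz := fiberMass μ Z
  let r : α × β × γ → ℝ := fun t =>
    pxz (t.1, t.2.2) * pyz (t.2.1, t.2.2) / (pxyz t * pz t.2.2)
  have key : ∑ ω, μ ω * r (X ω, Y ω, Z ω) ≤ ∑ ω, μ ω := by
    rw [sum_mul_comp_eq_sum_fiberMass μ (fun ω => (X ω, Y ω, Z ω)) r, ← sum_fiberMass μ Z]
    calc ∑ t, pxyz t * r t
        ≤ ∑ t : α × β × γ, pxz (t.1, t.2.2) * pyz (t.2.1, t.2.2) / pz t.2.2 := by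
          refine Finset.sum_le_sum fun t _ => ?_
          have h1 : 0 ≤ pxz (t.1, t.2.2) := fiberMass_nonneg hμ _ _
          have h2 : 0 ≤ pyz (t.2.1, t.2.2) := fiberMass_nonneg hμ _ _
          have h3 : 0 ≤ pz t.2.2 := fiberMass_nonneg hμ _ _
          rcases eq_or_ne (pxyz t) 0 with h | h
          · rw [h, zero_mul]; positivity
          · refine le_of_eq ?_
            simp only [r]
            rw [mul_div_assoc', mul_div_mul_left _ _ h]
      _ = ∑ z, ∑ x, ∑ y, pxz (x, z) * pyz (y, z) / pz z := by
          simp only [Fintype.sum_prod_type]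
          exact (Finset.sum_congr rfl fun x _ => Finset.sum_comm).trans Finset.sum_comm
      _ = ∑ z, pz z := by
          refine Finset.sum_congr rfl fun z _ => ?_
          simp only [← Finset.sum_div, ← Finset.mul_sum, ← Finset.sum_mul]
          rw [sum_fiberMass_fst μ X Z, sum_fiberMass_fst μ Y Z]
          exact mul_self_div_self _
  have step : ∑ ω, μ ω * (1 - r (X ω, Y ω, Z ω)) ≤ condMI μ X Y Z := by
    simp only [condMI, entropy_eq_sum_log, ← Finset.sum_add_distrib, ← Finset.sum_sub_distrib]
    refine Finset.sum_le_sum fun ω _ => ?_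
    rcases (hμ ω).eq_or_lt with h | h
    · simp [← h]
    · have h1 : 0 < pxz (X ω, Z ω) := fiberMass_pos hμ (fun ω => (X ω, Z ω)) h
      have h2 : 0 < pyz (Y ω, Z ω) := fiberMass_pos hμ (fun ω => (Y ω, Z ω)) h
      have h3 : 0 < pxyz (X ω, Y ω, Z ω) := fiberMass_pos hμ (fun ω => (X ω, Y ω, Z ω)) h
      have h4 : 0 < pz (Z ω) := fiberMass_pos hμ Z h
      have hlog := Real.log_le_sub_one_of_pos (x := r (X ω, Y ω, Z ω))
        (by simp only [r]; positivity)
      have hexp : Real.log (r (X ω, Y ω, Z ω)) = Real.log (pxz (X ω, Z ω))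
          + Real.log (pyz (Y ω, Z ω)) - Real.log (pxyz (X ω, Y ω, Z ω)) - Real.log (pz (Z ω)) := by
        simp only [r]
        rw [Real.log_div (by positivity) (by positivity), Real.log_mul h1.ne' h2.ne',
          Real.log_mul h3.ne' h4.ne']
        ring
      have := mul_le_mul_of_nonneg_left hlog h.le
      rw [hexp] at this
      linarith
  refine le_trans ?_ step
  simp only [mul_sub, mul_one, Finset.sum_sub_distrib]
  linarith

/-- Submodularity of entropy: `W` carries the join and `Z` a common part of `X` and `Y`. -/
theorem entropy_submodular {μ : Ω → ℝ} (hμ : ∀ ω, 0 ≤ μ ω) {X : Ω → α} {Y : Ω → β} {Z : Ω → γ}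
    {W : Ω → δ} (hXZ : ∀ ω ω', X ω = X ω' → Z ω = Z ω') (hYZ : ∀ ω ω', Y ω = Y ω' → Z ω = Z ω')
    (hW : ∀ ω ω', W ω = W ω' ↔ X ω = X ω' ∧ Y ω = Y ω') :
    entropy μ W + entropy μ Z ≤ entropy μ X + entropy μ Y := by
  have h := condMI_nonneg hμ X Y Z
  have h1 : entropy μ (fun ω => (X ω, Z ω)) = entropy μ X :=
    entropy_congr μ fun ω ω' => by simpa using hXZ ω ω'
  have h2 : entropy μ (fun ω => (Y ω, Z ω)) = entropy μ Y :=
    entropy_congr μ fun ω ω' => by simpa using hYZ ω ω'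
  have h3 : entropy μ (fun ω => (X ω, Y ω, Z ω)) = entropy μ W :=
    entropy_congr μ fun ω ω' => by
      rw [hW]
      simp only [Prod.mk.injEq]
      exact ⟨fun h => ⟨h.1, h.2.1⟩, fun h => ⟨h.1, h.2, hXZ _ _ h.1⟩⟩
  rw [condMI, h1, h2, h3] at h
  linarith

theorem entropy_pair_of_kernel {μ : Ω → ℝ} (hμ : ∀ ω, 0 ≤ μ ω) (V : Ω → α) (Z : Ω → γ)
    (K : Ω → α → ℝ)
    (h : ∀ ω, fiberMass μ (fun ω => (V ω, Z ω)) (V ω, Z ω) = fiberMass μ Z (Z ω) * K ω (V ω)) :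
    entropy μ (fun ω => (V ω, Z ω)) = entropy μ Z + ∑ ω, μ ω * -Real.log (K ω (V ω)) := by
  simp only [entropy_eq_sum_log, ← Finset.sum_add_distrib]
  refine Finset.sum_congr rfl fun ω _ => ?_
  rcases (hμ ω).eq_or_lt with h0 | h0
  · simp [← h0]
  · have h1 : 0 < fiberMass μ (fun ω => (V ω, Z ω)) (V ω, Z ω) :=
      fiberMass_pos hμ (fun ω => (V ω, Z ω)) h0
    rw [h] at h1 ⊢
    rw [Real.log_mul (left_ne_zero_of_mul h1.ne') (right_ne_zero_of_mul h1.ne')]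
    ring

/-- If resampling the coordinate `V` from the kernel `K` preserves the law `μ`, and `Z` determines
`K` and ignores `V`, then `K` is the conditional law of `V` given `Z`. -/
theorem fiberMass_pair_of_resample {μ : Ω → ℝ} (V : Ω → α) (Z : Ω → γ) (K : Ω → α → ℝ)
    (upd : α → Ω → Ω) (hV : ∀ a ω, V (upd a ω) = a) (hself : ∀ ω, upd (V ω) ω = ω)
    (hupd : ∀ a b ω, upd a (upd b ω) = upd a ω) (hZ : ∀ a ω, Z (upd a ω) = Z ω)
    (hK : ∀ ω ω', Z ω = Z ω' → K ω = K ω') (hsum : ∀ ω, ∑ a, K ω a = 1)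
    (hμ : ∀ a ω, μ (upd a ω) * K ω (V ω) = μ ω * K ω a) (ω₀ : Ω) :
    fiberMass μ (fun ω => (V ω, Z ω)) (V ω₀, Z ω₀) = fiberMass μ Z (Z ω₀) * K ω₀ (V ω₀) := by
  rw [← sum_fiberMass_fst μ V Z, Finset.sum_mul]
  have hshift : ∀ b, fiberMass μ (fun ω => (V ω, Z ω)) (b, Z ω₀) =
      ∑ ω ∈ Finset.univ.filter (fun ω => (V ω, Z ω) = (V ω₀, Z ω₀)), μ (upd b ω) := by
    intro b
    refine Finset.sum_bij' (fun ω _ => upd (V ω₀) ω) (fun ω _ => upd b ω) ?_ ?_ ?_ ?_ ?_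
    all_goals
      simp only [Finset.mem_filter, Finset.mem_univ, true_and, Prod.mk.injEq]
      rintro ω ⟨h1, h2⟩
      simp [hV, hZ, hupd, h2, ← h1, hself]
  simp only [hshift, Finset.sum_mul]
  rw [Finset.sum_comm]
  refine Finset.sum_congr rfl fun ω hω => ?_
  simp only [Finset.mem_filter, Finset.mem_univ, true_and, Prod.mk.injEq] at hω
  rw [hK ω₀ ω hω.2.symm, ← hω.1]
  simp only [hμ, ← Finset.mul_sum, hsum, mul_one, hself]

theorem entropy_family_of_resample {ι : Type*} [DecidableEq ι] {A : ι → Type*}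
    [∀ i, Fintype (A i)] [∀ i, DecidableEq (A i)] {μ : Ω → ℝ} (hμ : ∀ ω, 0 ≤ μ ω)
    (V : ∀ i, Ω → A i) (K : ∀ i, Ω → A i → ℝ) (upd : ∀ i, A i → Ω → Ω)
    (hV : ∀ i a ω, V i (upd i a ω) = a) (hVne : ∀ i j a ω, j ≠ i → V j (upd i a ω) = V j ω)
    (hself : ∀ i ω, upd i (V i ω) ω = ω)
    (hupd : ∀ i a b ω, upd i a (upd i b ω) = upd i a ω)
    (hsum : ∀ i ω, ∑ a, K i ω a = 1) (Z : Ω → γ) (S : Finset ι)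
    (hZ : ∀ i ∈ S, ∀ a ω, Z (upd i a ω) = Z ω)
    (hK : ∀ i ∈ S, ∀ ω ω', Z ω = Z ω' → K i ω = K i ω')
    (hres : ∀ i ∈ S, ∀ a ω, μ (upd i a ω) * K i ω (V i ω) = μ ω * K i ω a) :
    entropy μ (fun ω => ((fun i : S => V i ω : ∀ i : S, A i), Z ω)) =
      entropy μ Z + ∑ i ∈ S, ∑ ω, μ ω * -Real.log (K i ω (V i ω)) := by
  induction S using Finset.induction_on with
  | empty =>
    rw [Finset.sum_empty, add_zero]
    refine entropy_congr μ fun ω ω' => ?_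
    simp [funext_iff]
  | insert i S hi ih =>
    have ih' := ih (fun j hj => hZ j (Finset.mem_insert_of_mem hj))
      (fun j hj => hK j (Finset.mem_insert_of_mem hj))
      (fun j hj => hres j (Finset.mem_insert_of_mem hj))
    have hmem := Finset.mem_insert_self i S
    have hstep := entropy_pair_of_kernel hμ (V i)
      (fun ω => ((fun i : S => V i ω : ∀ i : S, A i), Z ω)) (K i)
      (fiberMass_pair_of_resample (V i) _ (K i) (upd i) (hV i) (hself i) (hupd i)
        (fun a ω => by
          refine Prod.ext (funext fun j => hVne i j a ω ?_) (hZ i hmem a ω)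
          rintro rfl
          exact hi j.2)
        (fun ω ω' h => hK i hmem ω ω' (Prod.ext_iff.1 h).2) (hsum i) (hres i hmem))
    rw [Finset.sum_insert hi, ← add_assoc, add_right_comm, ← ih', ← hstep]
    refine entropy_congr μ fun ω ω' => ?_
    simp [funext_iff, and_assoc]

theorem prod_update_mul {ι : Type*} [DecidableEq ι] {A : ι → Type*} (s : Finset ι)
    (f : ∀ i, A i → ℝ) (x : ∀ i, A i) {i : ι} (hi : i ∈ s) (a : A i) :
    (∏ j ∈ s, f j (Function.update x i a j)) * f i (x i) = (∏ j ∈ s, f j (x j)) * f i a := by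
  rw [← Finset.mul_prod_erase s _ hi, ← Finset.mul_prod_erase s (fun j => f j (x j)) hi]
  have : ∏ j ∈ s.erase i, f j (Function.update x i a j) = ∏ j ∈ s.erase i, f j (x j) :=
    Finset.prod_congr rfl fun j hj => by rw [Function.update_of_ne (Finset.ne_of_mem_erase hj)]
  rw [this, Function.update_self]
  ring

end EntropyFacts

section SetFunctions

variable {ι : Type*} [DecidableEq ι]

/-- The largest set at which `ψ` is strictly smaller than at all proper subsets minimizes `ψ`. -/
theorem minimizer_of_largest {N D : Finset ι} {ψ : Finset ι → ℝ}
    (hD : ∀ S ⊆ D, S.Nonempty → 0 < ψ (D \ S) - ψ D)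
    (hmax : ∀ E ⊆ N, (∀ S ⊆ E, S.Nonempty → 0 < ψ (E \ S) - ψ E) → E ⊆ D)
    {T : Finset ι} (hT : T ⊆ N) : ψ D ≤ ψ T := by
  induction T using Finset.strongInduction with
  | H T ih =>
    by_cases h : ∀ S ⊆ T, S.Nonempty → 0 < ψ (T \ S) - ψ T
    · have hTD := hmax T hT h
      rcases (D \ T).eq_empty_or_nonempty with h0 | h0
      · rw [(Finset.sdiff_eq_empty_iff_subset.1 h0).antisymm hTD]
      · have := hD _ Finset.sdiff_subset h0
        rw [Finset.sdiff_sdiff_eq_self hTD] at this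
        linarith
    · push Not at h
      obtain ⟨S, hS, hne, hle⟩ := h
      have := ih (T \ S) (Finset.sdiff_ssubset hS hne) (Finset.sdiff_subset.trans hT)
      linarith

theorem inf'_largest_eq_sup' {N D : Finset ι} {φ ψ : Finset ι → ℝ} {F : Finset ι → ℝ}
    (hF : ∀ T ⊆ N, F T = T.powerset.inf' (Finset.powerset_nonempty T) fun S => φ (T \ S) - ψ T)
    (hsub : ∀ A ⊆ N, ∀ B ⊆ N, ψ (A ∪ B) + ψ (A ∩ B) ≤ ψ A + ψ B)
    (hmono : ∀ B ⊆ N, ∀ A ⊆ B, φ A - ψ A ≤ φ B - ψ B) (hDN : D ⊆ N)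
    (hD : ∀ S ⊆ D, S.Nonempty → 0 < ψ (D \ S) - ψ D)
    (hmax : ∀ E ⊆ N, (∀ S ⊆ E, S.Nonempty → 0 < ψ (E \ S) - ψ E) → E ⊆ D) :
    F D = N.powerset.sup' (Finset.powerset_nonempty N) F := by
  refine le_antisymm (Finset.le_sup' F (Finset.mem_powerset.2 hDN)) (Finset.sup'_le _ _ ?_)
  intro T hT
  rw [Finset.mem_powerset] at hT
  rw [hF D hDN, hF T hT]
  refine Finset.le_inf' _ _ fun S hS => ?_
  set W := D \ S with hW
  have hWN : W ⊆ N := Finset.sdiff_subset.trans hDN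
  have hmin := minimizer_of_largest hD hmax (Finset.union_subset hWN hT)
  have h1 := hsub W hWN T hT
  have h2 := hmono W hWN (W ∩ T) Finset.inter_subset_left
  refine (Finset.inf'_le _ (b := T \ W) (by simp)).trans ?_
  rw [sdiff_sdiff_right_self, Finset.inf_eq_inter, Finset.inter_comm]
  linarith

end SetFunctions

section RelayChannel

variable {n Mc : ℕ} {QA X0A YdA : Type} {XA YA YhA : Fin n → Type}

theorem upSet_union_downSet {ℳ : Finset (Fin n)} {σ : Fin Mc → Fin n} (hσmem : ∀ j, σ j ∈ ℳ)
    (hσsurj : ∀ i ∈ ℳ, ∃ j, σ j = i) (k : Fin (Mc + 1)) : upSet σ k ∪ downSet σ k = ℳ := by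
  ext i
  simp only [upSet, downSet, Finset.mem_union, Finset.mem_image, Finset.mem_filter,
    Finset.mem_univ, true_and]
  constructor
  · rintro (⟨j, -, rfl⟩ | ⟨j, -, rfl⟩) <;> exact hσmem j
  · intro hi
    obtain ⟨j, rfl⟩ := hσsurj i hi
    exact (lt_or_ge (j : ℕ) k).imp (fun h => ⟨j, h, rfl⟩) fun h => ⟨j, h, rfl⟩

theorem rvXS_eq_iff (S : Finset (Fin n)) (ω ω' : DFOmega QA X0A XA YA YdA YhA) :
    rvXS S ω = rvXS S ω' ↔ ∀ i ∈ S, ω.2.2.1 i = ω'.2.2.1 i := by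
  simp [rvXS, funext_iff]

theorem rvYS_eq_iff (S : Finset (Fin n)) (ω ω' : DFOmega QA X0A XA YA YdA YhA) :
    rvYS S ω = rvYS S ω' ↔ ∀ i ∈ S, ω.2.2.2.1 i = ω'.2.2.2.1 i := by
  simp [rvYS, funext_iff]

theorem rvYhS_eq_iff (S : Finset (Fin n)) (ω ω' : DFOmega QA X0A XA YA YdA YhA) :
    rvYhS S ω = rvYhS S ω' ↔ ∀ i ∈ S, ω.2.2.2.2.2 i = ω'.2.2.2.2.2 i := by
  simp [rvYhS, funext_iff]

theorem rvXS_union_eq_iff (S T : Finset (Fin n)) (ω ω' : DFOmega QA X0A XA YA YdA YhA) :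
    rvXS (S ∪ T) ω = rvXS (S ∪ T) ω' ↔ rvXS S ω = rvXS S ω' ∧ rvXS T ω = rvXS T ω' := by
  simp only [rvXS_eq_iff, Finset.forall_mem_union]

theorem rvYhS_union_eq_iff (S T : Finset (Fin n)) (ω ω' : DFOmega QA X0A XA YA YdA YhA) :
    rvYhS (S ∪ T) ω = rvYhS (S ∪ T) ω' ↔ rvYhS S ω = rvYhS S ω' ∧ rvYhS T ω = rvYhS T ω' := by
  simp only [rvYhS_eq_iff, Finset.forall_mem_union]

theorem rvXS_eq_of_subset {S T : Finset (Fin n)} (h : S ⊆ T)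
    {ω ω' : DFOmega QA X0A XA YA YdA YhA} (hT : rvXS T ω = rvXS T ω') :
    rvXS S ω = rvXS S ω' := by
  rw [rvXS_eq_iff] at hT ⊢
  exact fun i hi => hT i (h hi)

theorem rvYhS_eq_of_subset {S T : Finset (Fin n)} (h : S ⊆ T)
    {ω ω' : DFOmega QA X0A XA YA YdA YhA} (hT : rvYhS T ω = rvYhS T ω') :
    rvYhS S ω = rvYhS S ω' := by
  rw [rvYhS_eq_iff] at hT ⊢
  exact fun i hi => hT i (h hi)

theorem muDF_nonneg {ℳ : Finset (Fin n)} {pQ : QA → ℝ} {p0 : QA → X0A → ℝ}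
    {pM : QA → X0A → (∀ i : ℳ, XA i) → ℝ} {pC : ∀ i : Fin n, QA → XA i → ℝ}
    {W : X0A → (∀ i, XA i) → ((∀ i, YA i) × YdA) → ℝ}
    {κ : ∀ i : Fin n, QA → YA i → XA i → YhA i → ℝ}
    (hpQ : ∀ q, 0 ≤ pQ q) (hp0 : ∀ q x, 0 ≤ p0 q x) (hpM : ∀ q x0 xm, 0 ≤ pM q x0 xm)
    (hpC : ∀ i q x, 0 ≤ pC i q x) (hW : ∀ x0 x y, 0 ≤ W x0 x y)
    (hκ : ∀ i q y x yh, 0 ≤ κ i q y x yh) (ω : DFOmega QA X0A XA YA YdA YhA) :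
    0 ≤ muDF ℳ pQ p0 pM pC W κ ω :=
  mul_nonneg (mul_nonneg (mul_nonneg (mul_nonneg (mul_nonneg (hpQ _) (hp0 _ _)) (hpM _ _ _))
    (Finset.prod_nonneg fun _ _ => hpC _ _ _)) (hW _ _ _))
    (Finset.prod_nonneg fun _ _ => hκ _ _ _ _ _)

variable [Fintype QA] [DecidableEq QA] [Fintype X0A] [DecidableEq X0A]
  [Fintype YdA] [DecidableEq YdA]
  [∀ i, Fintype (XA i)] [∀ i, DecidableEq (XA i)]
  [∀ i, Fintype (YA i)] [∀ i, DecidableEq (YA i)]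
  [∀ i, Fintype (YhA i)] [∀ i, DecidableEq (YhA i)]

/-- `H(Ŷ_T, Y_{π(k)} | X_T, Z) - ∑_{i∈T} c i`. -/
noncomputable def outputPotential {ζ : Type*} [Fintype ζ] [DecidableEq ζ] (σ : Fin Mc → Fin n)
    (μ : DFOmega QA X0A XA YA YdA YhA → ℝ) (c : Fin n → ℝ) (k : Fin (Mc + 1))
    (Z : DFOmega QA X0A XA YA YdA YhA → ζ) (T : Finset (Fin n)) : ℝ :=
  entropy μ (fun ω => (rvYhS T ω, rvYk σ k ω, rvXS T ω, Z ω))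
    - entropy μ (fun ω => (rvXS T ω, Z ω)) - ∑ i ∈ T, c i

/-- If `Ŷ_S` has conditional entropy `∑_{i∈S} c i` given `Y_S` and the other variables, the
quantization cost is a difference of two entropies up to `∑_{i∈S} c i`. -/
theorem condMI_quantization {ℳ : Finset (Fin n)} {σ : Fin Mc → Fin n}
    {μ : DFOmega QA X0A XA YA YdA YhA → ℝ} {c : Fin n → ℝ} {k : Fin (Mc + 1)}
    {S T : Finset (Fin n)} (hST : S ⊆ T)
    (hc : entropy μ (fun ω => (rvYhS S ω, rvYS S ω,
        ((rvX0 ω, rvXS ℳ ω), rvXS T ω, rvYk σ k ω, rvYhS (T \ S) ω, rvQ ω))) =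
      entropy μ (fun ω => (rvYS S ω,
        ((rvX0 ω, rvXS ℳ ω), rvXS T ω, rvYk σ k ω, rvYhS (T \ S) ω, rvQ ω))) + ∑ i ∈ S, c i) :
    condMI μ (rvYS S) (rvYhS S)
        (fun ω => ((rvX0 ω, rvXS ℳ ω), rvXS T ω, rvYk σ k ω, rvYhS (T \ S) ω, rvQ ω)) =
      entropy μ (fun ω => (rvYhS T ω, rvYk σ k ω, rvXS T ω, (rvX0 ω, rvXS ℳ ω), rvQ ω))
        - entropy μ (fun ω => (rvYhS (T \ S) ω, rvYk σ k ω, rvXS T ω,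
          (rvX0 ω, rvXS ℳ ω), rvQ ω)) - ∑ i ∈ S, c i := by
  have e1 : entropy μ (fun ω => (rvYhS S ω,
        ((rvX0 ω, rvXS ℳ ω), rvXS T ω, rvYk σ k ω, rvYhS (T \ S) ω, rvQ ω))) =
      entropy μ (fun ω => (rvYhS T ω, rvYk σ k ω, rvXS T ω, (rvX0 ω, rvXS ℳ ω), rvQ ω)) :=
    entropy_congr μ fun ω ω' => by
      have hT : rvYhS T ω = rvYhS T ω' ↔
          rvYhS S ω = rvYhS S ω' ∧ rvYhS (T \ S) ω = rvYhS (T \ S) ω' := by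
        rw [← rvYhS_union_eq_iff, Finset.union_sdiff_of_subset hST]
      simp only [Prod.mk.injEq, hT]
      tauto
  have e2 : entropy μ (fun ω =>
        ((rvX0 ω, rvXS ℳ ω), rvXS T ω, rvYk σ k ω, rvYhS (T \ S) ω, rvQ ω)) =
      entropy μ (fun ω => (rvYhS (T \ S) ω, rvYk σ k ω, rvXS T ω,
          (rvX0 ω, rvXS ℳ ω), rvQ ω)) :=
    entropy_congr μ fun ω ω' => by
      simp only [Prod.mk.injEq]
      tauto
  have e3 : entropy μ (fun ω => (rvYS S ω, rvYhS S ω,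
        ((rvX0 ω, rvXS ℳ ω), rvXS T ω, rvYk σ k ω, rvYhS (T \ S) ω, rvQ ω))) =
      entropy μ (fun ω => (rvYhS S ω, rvYS S ω,
        ((rvX0 ω, rvXS ℳ ω), rvXS T ω, rvYk σ k ω, rvYhS (T \ S) ω, rvQ ω))) :=
    entropy_congr μ fun ω ω' => by
      simp only [Prod.mk.injEq]
      tauto
  rw [condMI, e1, e2, e3, hc]
  ring

/-- The bracket in the definition of `Fk` as a difference of potentials. -/
theorem condMI_decode_sub_condMI_quantization {ℳ : Finset (Fin n)} {σ : Fin Mc → Fin n}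
    {μ : DFOmega QA X0A XA YA YdA YhA → ℝ} {c : Fin n → ℝ} {k : Fin (Mc + 1)}
    (hU : upSet σ k ∪ downSet σ k = ℳ) {S T : Finset (Fin n)} (hST : S ⊆ T)
    (hc : entropy μ (fun ω => (rvYhS S ω, rvYS S ω,
        ((rvX0 ω, rvXS ℳ ω), rvXS T ω, rvYk σ k ω, rvYhS (T \ S) ω, rvQ ω))) =
      entropy μ (fun ω => (rvYS S ω,
        ((rvX0 ω, rvXS ℳ ω), rvXS T ω, rvYk σ k ω, rvYhS (T \ S) ω, rvQ ω))) + ∑ i ∈ S, c i) :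
    condMI μ (fun ω => ((rvX0 ω, rvXS (upSet σ k) ω), rvXS S ω))
        (fun ω => (rvYhS (T \ S) ω, rvYk σ k ω))
        (fun ω => (rvXS (T \ S) ω, rvXS (downSet σ k) ω, rvQ ω))
      - condMI μ (rvYS S) (rvYhS S)
        (fun ω => ((rvX0 ω, rvXS ℳ ω), rvXS T ω, rvYk σ k ω, rvYhS (T \ S) ω, rvQ ω)) =
      outputPotential σ μ c k (fun ω => (rvXS (downSet σ k) ω, rvQ ω)) (T \ S)
        - outputPotential σ μ c k (fun ω => ((rvX0 ω, rvXS ℳ ω), rvQ ω)) T := by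
  have e1 : entropy μ (fun ω => (((rvX0 ω, rvXS (upSet σ k) ω), rvXS S ω),
        (rvXS (T \ S) ω, rvXS (downSet σ k) ω, rvQ ω))) =
      entropy μ (fun ω => (rvXS T ω, (rvX0 ω, rvXS ℳ ω), rvQ ω)) :=
    entropy_congr μ fun ω ω' => by
      conv_rhs => rw [← Finset.union_sdiff_of_subset hST, ← hU]
      simp only [Prod.mk.injEq, rvXS_union_eq_iff]
      tauto
  have e2 : entropy μ (fun ω => ((rvYhS (T \ S) ω, rvYk σ k ω),
        (rvXS (T \ S) ω, rvXS (downSet σ k) ω, rvQ ω))) =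
      entropy μ (fun ω => (rvYhS (T \ S) ω, rvYk σ k ω, rvXS (T \ S) ω,
        rvXS (downSet σ k) ω, rvQ ω)) :=
    entropy_congr μ fun ω ω' => by
      simp only [Prod.mk.injEq]
      tauto
  have e3 : entropy μ (fun ω => (((rvX0 ω, rvXS (upSet σ k) ω), rvXS S ω),
        (rvYhS (T \ S) ω, rvYk σ k ω), (rvXS (T \ S) ω, rvXS (downSet σ k) ω, rvQ ω))) =
      entropy μ (fun ω => (rvYhS (T \ S) ω, rvYk σ k ω, rvXS T ω,
        (rvX0 ω, rvXS ℳ ω), rvQ ω)) :=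
    entropy_congr μ fun ω ω' => by
      have hT : rvXS T ω = rvXS T ω' ↔ rvXS S ω = rvXS S ω' ∧ rvXS (T \ S) ω = rvXS (T \ S) ω' := by
        rw [← rvXS_union_eq_iff, Finset.union_sdiff_of_subset hST]
      have hM : rvXS ℳ ω = rvXS ℳ ω' ↔ rvXS (upSet σ k) ω = rvXS (upSet σ k) ω' ∧
          rvXS (downSet σ k) ω = rvXS (downSet σ k) ω' := by
        rw [← rvXS_union_eq_iff, hU]
      simp only [Prod.mk.injEq, hT, hM]
      tauto
  rw [condMI_quantization hST hc, condMI, e1, e2, e3, outputPotential, outputPotential,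
    ← Finset.sum_sdiff hST]
  ring

/-- The expression in the definition of `SelfDecodable` as a difference of potentials. -/
theorem condMI_selfDecode_sub_condMI_quantization {ℳ : Finset (Fin n)} {σ : Fin Mc → Fin n}
    {μ : DFOmega QA X0A XA YA YdA YhA → ℝ} {c : Fin n → ℝ} {k : Fin (Mc + 1)}
    {S T : Finset (Fin n)} (hST : S ⊆ T)
    (hc : entropy μ (fun ω => (rvYhS S ω, rvYS S ω,
        ((rvX0 ω, rvXS ℳ ω), rvXS T ω, rvYk σ k ω, rvYhS (T \ S) ω, rvQ ω))) =
      entropy μ (fun ω => (rvYS S ω,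
        ((rvX0 ω, rvXS ℳ ω), rvXS T ω, rvYk σ k ω, rvYhS (T \ S) ω, rvQ ω))) + ∑ i ∈ S, c i) :
    condMI μ (rvXS S) (fun ω => (rvYhS (T \ S) ω, rvYk σ k ω))
        (fun ω => ((rvX0 ω, rvXS ℳ ω), rvXS (T \ S) ω, rvQ ω))
      - condMI μ (rvYS S) (rvYhS S)
        (fun ω => ((rvX0 ω, rvXS ℳ ω), rvXS T ω, rvYk σ k ω, rvYhS (T \ S) ω, rvQ ω)) =
      outputPotential σ μ c k (fun ω => ((rvX0 ω, rvXS ℳ ω), rvQ ω)) (T \ S)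
        - outputPotential σ μ c k (fun ω => ((rvX0 ω, rvXS ℳ ω), rvQ ω)) T := by
  have hT : ∀ ω ω' : DFOmega QA X0A XA YA YdA YhA, rvXS T ω = rvXS T ω' ↔
      rvXS S ω = rvXS S ω' ∧ rvXS (T \ S) ω = rvXS (T \ S) ω' := fun ω ω' => by
    rw [← rvXS_union_eq_iff, Finset.union_sdiff_of_subset hST]
  have e1 : entropy μ (fun ω => (rvXS S ω, ((rvX0 ω, rvXS ℳ ω), rvXS (T \ S) ω, rvQ ω))) =
      entropy μ (fun ω => (rvXS T ω, (rvX0 ω, rvXS ℳ ω), rvQ ω)) :=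
    entropy_congr μ fun ω ω' => by
      simp only [Prod.mk.injEq, hT]
      tauto
  have e2 : entropy μ (fun ω => ((rvYhS (T \ S) ω, rvYk σ k ω),
        ((rvX0 ω, rvXS ℳ ω), rvXS (T \ S) ω, rvQ ω))) =
      entropy μ (fun ω => (rvYhS (T \ S) ω, rvYk σ k ω, rvXS (T \ S) ω,
        (rvX0 ω, rvXS ℳ ω), rvQ ω)) :=
    entropy_congr μ fun ω ω' => by
      simp only [Prod.mk.injEq]
      tauto
  have e3 : entropy μ (fun ω => (rvXS S ω, (rvYhS (T \ S) ω, rvYk σ k ω),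
        ((rvX0 ω, rvXS ℳ ω), rvXS (T \ S) ω, rvQ ω))) =
      entropy μ (fun ω => (rvYhS (T \ S) ω, rvYk σ k ω, rvXS T ω,
        (rvX0 ω, rvXS ℳ ω), rvQ ω)) :=
    entropy_congr μ fun ω ω' => by
      simp only [Prod.mk.injEq, hT]
      tauto
  have e4 : entropy μ (fun ω => ((rvX0 ω, rvXS ℳ ω), rvXS (T \ S) ω, rvQ ω)) =
      entropy μ (fun ω => (rvXS (T \ S) ω, (rvX0 ω, rvXS ℳ ω), rvQ ω)) :=
    entropy_congr μ fun ω ω' => by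
      simp only [Prod.mk.injEq]
      tauto
  rw [condMI_quantization hST hc, condMI, e1, e2, e3, e4, outputPotential, outputPotential,
    ← Finset.sum_sdiff hST]
  ring

/-- With independent inputs `X_i`, `i ∈ N`, given `Z`, the potential is submodular. -/
theorem outputPotential_submodular {ζ : Type*} [Fintype ζ] [DecidableEq ζ] {σ : Fin Mc → Fin n}
    {μ : DFOmega QA X0A XA YA YdA YhA → ℝ} (hμ : ∀ ω, 0 ≤ μ ω) {c d : Fin n → ℝ}
    {k : Fin (Mc + 1)} {Z : DFOmega QA X0A XA YA YdA YhA → ζ} {N : Finset (Fin n)}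
    (hd : ∀ T ⊆ N, entropy μ (fun ω => (rvXS T ω, Z ω)) = entropy μ Z + ∑ i ∈ T, d i)
    {A B : Finset (Fin n)} (hA : A ⊆ N) (hB : B ⊆ N) :
    outputPotential σ μ c k Z (A ∪ B) + outputPotential σ μ c k Z (A ∩ B) ≤
      outputPotential σ μ c k Z A + outputPotential σ μ c k Z B := by
  have h := entropy_submodular hμ
    (X := fun ω => (rvYhS A ω, rvYk σ k ω, rvXS A ω, Z ω))
    (Y := fun ω => (rvYhS B ω, rvYk σ k ω, rvXS B ω, Z ω))
    (Z := fun ω => (rvYhS (A ∩ B) ω, rvYk σ k ω, rvXS (A ∩ B) ω, Z ω))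
    (W := fun ω => (rvYhS (A ∪ B) ω, rvYk σ k ω, rvXS (A ∪ B) ω, Z ω))
    (fun ω ω' h => by
      simp only [Prod.mk.injEq] at h ⊢
      exact ⟨rvYhS_eq_of_subset Finset.inter_subset_left h.1, h.2.1,
        rvXS_eq_of_subset Finset.inter_subset_left h.2.2.1, h.2.2.2⟩)
    (fun ω ω' h => by
      simp only [Prod.mk.injEq] at h ⊢
      exact ⟨rvYhS_eq_of_subset Finset.inter_subset_right h.1, h.2.1,
        rvXS_eq_of_subset Finset.inter_subset_right h.2.2.1, h.2.2.2⟩)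
    (fun ω ω' => by
      simp only [Prod.mk.injEq, rvXS_union_eq_iff, rvYhS_union_eq_iff]
      tauto)
  have hsd := Finset.sum_union_inter (s₁ := A) (s₂ := B) (f := d)
  have hsc := Finset.sum_union_inter (s₁ := A) (s₂ := B) (f := c)
  simp only [outputPotential]
  rw [hd _ hA, hd _ hB, hd _ (Finset.union_subset hA hB),
    hd _ (Finset.inter_subset_left.trans hA)]
  linarith

/-- Conditioning on the finer `Z'` rather than on `Z` decreases the potential by an amount which
grows with the set. -/
theorem outputPotential_sub_mono {ζ ζ' : Type*} [Fintype ζ] [DecidableEq ζ] [Fintype ζ']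
    [DecidableEq ζ'] {σ : Fin Mc → Fin n}
    {μ : DFOmega QA X0A XA YA YdA YhA → ℝ} (hμ : ∀ ω, 0 ≤ μ ω) {c d : Fin n → ℝ}
    {k : Fin (Mc + 1)} {Z : DFOmega QA X0A XA YA YdA YhA → ζ}
    {Z' : DFOmega QA X0A XA YA YdA YhA → ζ'} {N : Finset (Fin n)}
    (hZ : ∀ ω ω', Z' ω = Z' ω' → Z ω = Z ω')
    (hd : ∀ T ⊆ N, entropy μ (fun ω => (rvXS T ω, Z ω)) = entropy μ Z + ∑ i ∈ T, d i)
    (hd' : ∀ T ⊆ N, entropy μ (fun ω => (rvXS T ω, Z' ω)) = entropy μ Z' + ∑ i ∈ T, d i)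
    {A B : Finset (Fin n)} (hB : B ⊆ N) (hAB : A ⊆ B) :
    outputPotential σ μ c k Z A - outputPotential σ μ c k Z' A ≤
      outputPotential σ μ c k Z B - outputPotential σ μ c k Z' B := by
  have h := entropy_submodular hμ
    (X := fun ω => (rvYhS A ω, rvYk σ k ω, rvXS A ω, Z' ω))
    (Y := fun ω => (rvYhS B ω, rvYk σ k ω, rvXS B ω, Z ω))
    (Z := fun ω => (rvYhS A ω, rvYk σ k ω, rvXS A ω, Z ω))
    (W := fun ω => (rvYhS B ω, rvYk σ k ω, rvXS B ω, Z' ω))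
    (fun ω ω' h => by
      simp only [Prod.mk.injEq] at h ⊢
      exact ⟨h.1, h.2.1, h.2.2.1, hZ _ _ h.2.2.2⟩)
    (fun ω ω' h => by
      simp only [Prod.mk.injEq] at h ⊢
      exact ⟨rvYhS_eq_of_subset hAB h.1, h.2.1, rvXS_eq_of_subset hAB h.2.2.1, h.2.2.2⟩)
    (fun ω ω' => by
      simp only [Prod.mk.injEq]
      exact ⟨fun h => ⟨⟨rvYhS_eq_of_subset hAB h.1, h.2.1, rvXS_eq_of_subset hAB h.2.2.1,
        h.2.2.2⟩, h.1, h.2.1, h.2.2.1, hZ _ _ h.2.2.2⟩, fun h => ⟨h.2.1, h.1.2.1, h.2.2.2.1,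
        h.1.2.2.2⟩⟩)
  simp only [outputPotential]
  rw [hd _ hB, hd' _ hB, hd _ (hAB.trans hB), hd' _ (hAB.trans hB)]
  linarith

/-- The joint pmf of `Q` and the channel inputs. -/
noncomputable def inputLaw (ℳ : Finset (Fin n)) (pQ : QA → ℝ) (p0 : QA → X0A → ℝ)
    (pM : QA → X0A → (∀ i : ℳ, XA i) → ℝ) (pC : ∀ i : Fin n, QA → XA i → ℝ) :
    QA × X0A × (∀ i, XA i) → ℝ :=
  fun ω => pQ ω.1 * p0 ω.1 ω.2.1 * pM ω.1 ω.2.1 (fun i => ω.2.2 i) * ∏ i ∈ ℳᶜ, pC i ω.1 (ω.2.2 i)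

theorem sum_muDF_mul {ℳ : Finset (Fin n)} {pQ : QA → ℝ} {p0 : QA → X0A → ℝ}
    {pM : QA → X0A → (∀ i : ℳ, XA i) → ℝ} {pC : ∀ i : Fin n, QA → XA i → ℝ}
    {W : X0A → (∀ i, XA i) → ((∀ i, YA i) × YdA) → ℝ}
    {κ : ∀ i : Fin n, QA → YA i → XA i → YhA i → ℝ}
    (hWs : ∀ x0 x, ∑ y, W x0 x y = 1) (hκs : ∀ i q y x, ∑ yh, κ i q y x yh = 1)
    (f : QA × X0A × (∀ i, XA i) → ℝ) :
    ∑ ω : DFOmega QA X0A XA YA YdA YhA,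
        muDF ℳ pQ p0 pM pC W κ ω * f (ω.1, ω.2.1, ω.2.2.1) =
      ∑ ω, inputLaw ℳ pQ p0 pM pC ω * f ω := by
  have hWs' : ∀ x0 x, ∑ y, ∑ yd, W x0 x (y, yd) = 1 := fun x0 x => by
    rw [← Fintype.sum_prod_type, hWs]
  have hκs' : ∀ (q : QA) (y : ∀ i, YA i) (x : ∀ i, XA i),
      ∑ yh : ∀ i, YhA i, ∏ i, κ i q (y i) (x i) (yh i) = 1 := fun q y x => by
    rw [← Fintype.prod_sum]
    simp [hκs]
  simp only [Fintype.sum_prod_type, muDF, inputLaw]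
  refine Finset.sum_congr rfl fun q _ => Finset.sum_congr rfl fun x0 _ =>
    Finset.sum_congr rfl fun x _ => ?_
  simp only [← Finset.sum_mul, ← Finset.mul_sum, hκs', hWs', mul_one]

/-- The relay inputs outside `ℳ` are conditionally independent given any variable `Z` which is a
function of `Q`, `X₀` and `X_ℳ` and determines `Q`. -/
theorem entropy_rvXS_pair {ζ : Type*} [Fintype ζ] [DecidableEq ζ]
    {ℳ : Finset (Fin n)} {pQ : QA → ℝ} {p0 : QA → X0A → ℝ}
    {pM : QA → X0A → (∀ i : ℳ, XA i) → ℝ} {pC : ∀ i : Fin n, QA → XA i → ℝ}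
    {W : X0A → (∀ i, XA i) → ((∀ i, YA i) × YdA) → ℝ}
    {κ : ∀ i : Fin n, QA → YA i → XA i → YhA i → ℝ}
    (hpQ : ∀ q, 0 ≤ pQ q) (hp0 : ∀ q x, 0 ≤ p0 q x) (hpM : ∀ q x0 xm, 0 ≤ pM q x0 xm)
    (hpC : ∀ i q x, 0 ≤ pC i q x) (hpCs : ∀ i q, ∑ x, pC i q x = 1)
    (hWs : ∀ x0 x, ∑ y, W x0 x y = 1) (hκs : ∀ i q y x, ∑ yh, κ i q y x yh = 1)
    (Z : QA × X0A × (∀ i, XA i) → ζ) (hZQ : ∀ ω ω', Z ω = Z ω' → ω.1 = ω'.1)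
    (hZ : ∀ q x0 x x', (∀ i ∈ ℳ, x i = x' i) → Z (q, x0, x) = Z (q, x0, x'))
    {T : Finset (Fin n)} (hT : T ⊆ ℳᶜ) :
    entropy (muDF ℳ pQ p0 pM pC W κ) (fun ω => (rvXS T ω, Z (ω.1, ω.2.1, ω.2.2.1))) =
      entropy (muDF ℳ pQ p0 pM pC W κ) (fun ω => Z (ω.1, ω.2.1, ω.2.2.1)) +
        ∑ i ∈ T, ∑ ω, inputLaw ℳ pQ p0 pM pC ω * -Real.log (pC i ω.1 (ω.2.2 i)) := by
  have hmap := sum_muDF_mul (ℳ := ℳ) (pQ := pQ) (p0 := p0) (pM := pM) (pC := pC) hWs hκs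
  have e1 := entropy_comp_of_map _ hmap Z
  have e2 := entropy_comp_of_map _ hmap
    (fun ω => ((fun i : T => ω.2.2 i : ∀ i : T, XA i), Z ω))
  have e3 : entropy (muDF ℳ pQ p0 pM pC W κ) (fun ω => (rvXS T ω, Z (ω.1, ω.2.1, ω.2.2.1))) =
      entropy (muDF ℳ pQ p0 pM pC W κ) (fun ω =>
        ((fun i : T => ω.2.2.1 i : ∀ i : T, XA i), Z (ω.1, ω.2.1, ω.2.2.1))) :=
    entropy_congr _ fun _ _ => Iff.rfl
  rw [e3, e1, e2]
  have hne : ∀ i ∈ T, ∀ j ∈ ℳ, j ≠ i := by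
    rintro i hi j hj rfl
    exact Finset.mem_compl.1 (hT hi) hj
  have hν : ∀ ω, 0 ≤ inputLaw ℳ pQ p0 pM pC ω := fun ω =>
    mul_nonneg (mul_nonneg (mul_nonneg (hpQ _) (hp0 _ _)) (hpM _ _ _))
      (Finset.prod_nonneg fun _ _ => hpC _ _ _)
  refine entropy_family_of_resample hν (fun i ω => ω.2.2 i) (fun i ω => pC i ω.1)
    (fun i a ω => (ω.1, ω.2.1, Function.update ω.2.2 i a)) ?_ ?_ ?_ ?_ ?_ Z T ?_ ?_ ?_
  · simp
  · intro i j a ω h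
    simp [h]
  · simp
  · simp
  · exact fun i ω => hpCs i ω.1
  · exact fun i hi a ω => hZ _ _ _ _ fun j hj => Function.update_of_ne (hne i hi j hj) _ _
  · exact fun i _ ω ω' h => by rw [hZQ ω ω' h]
  · intro i hi a ω
    have hpM' : (fun j : ℳ => Function.update ω.2.2 i a j) = fun j : ℳ => ω.2.2 j :=
      funext fun j => Function.update_of_ne (hne i hi j j.2) _ _
    simp only [inputLaw, hpM']
    rw [mul_assoc, prod_update_mul _ (fun i => pC i ω.1) _ (hT hi)]
    ring

/-- The compressions are conditionally independent given the variables they are computed from. -/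
theorem entropy_rvYhS_pair {ζ : Type*} [Fintype ζ] [DecidableEq ζ]
    {ℳ : Finset (Fin n)} {pQ : QA → ℝ} {p0 : QA → X0A → ℝ}
    {pM : QA → X0A → (∀ i : ℳ, XA i) → ℝ} {pC : ∀ i : Fin n, QA → XA i → ℝ}
    {W : X0A → (∀ i, XA i) → ((∀ i, YA i) × YdA) → ℝ}
    {κ : ∀ i : Fin n, QA → YA i → XA i → YhA i → ℝ}
    (hμ : ∀ ω, 0 ≤ muDF ℳ pQ p0 pM pC W κ ω) (hκs : ∀ i q y x, ∑ yh, κ i q y x yh = 1)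
    (Z : DFOmega QA X0A XA YA YdA YhA → ζ) {S : Finset (Fin n)}
    (hZ : ∀ q x0 x y yd yh, ∀ i ∈ S, ∀ a,
      Z (q, x0, x, y, yd, Function.update yh i a) = Z (q, x0, x, y, yd, yh))
    (hZdet : ∀ ω ω', Z ω = Z ω' → rvQ ω = rvQ ω' ∧ rvYS S ω = rvYS S ω' ∧ rvXS S ω = rvXS S ω') :
    entropy (muDF ℳ pQ p0 pM pC W κ) (fun ω => (rvYhS S ω, Z ω)) =
      entropy (muDF ℳ pQ p0 pM pC W κ) Z +
        ∑ i ∈ S, ∑ ω, muDF ℳ pQ p0 pM pC W κ ω *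
          -Real.log (κ i ω.1 (ω.2.2.2.1 i) (ω.2.2.1 i) (ω.2.2.2.2.2 i)) := by
  refine entropy_family_of_resample hμ (fun i ω => ω.2.2.2.2.2 i)
    (fun i ω => κ i ω.1 (ω.2.2.2.1 i) (ω.2.2.1 i))
    (fun i a ω => (ω.1, ω.2.1, ω.2.2.1, ω.2.2.2.1, ω.2.2.2.2.1,
      Function.update ω.2.2.2.2.2 i a)) ?_ ?_ ?_ ?_ ?_ Z S ?_ ?_ ?_
  · simp
  · intro i j a ω h
    simp [h]
  · simp
  · simp
  · exact fun i ω => hκs i _ _ _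
  · exact fun i hi a ω => hZ _ _ _ _ _ _ i hi a
  · intro i hi ω ω' h
    obtain ⟨hQ, hY, hX⟩ := hZdet ω ω' h
    rw [rvYS_eq_iff] at hY
    rw [rvXS_eq_iff] at hX
    rw [show ω.1 = ω'.1 from hQ, hY i hi, hX i hi]
  · intro i hi a ω
    simp only [muDF]
    rw [mul_assoc, prod_update_mul _ (fun i => κ i ω.1 (ω.2.2.2.1 i) (ω.2.2.1 i)) _
      (Finset.mem_univ i)]
    ring

end RelayChannel

/-- The achievable rates of block-by-block backward decoding and of
`B`-blocks-by-`B`-blocks backward decoding coincide: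
`min_{k∈{2,…,M+2}} F_k(D_k) = min_{k∈{2,…,M+2}} max_{T_k ⊆ N∖M} F_k(T_k)`, where for
each `k` (encoded as `k : Fin (Mc+1)`), `D_k` is the unique largest subset of `N∖M`
that is self-decodable at node `π(k)`. -/
theorem min_Fk_largest_selfDecodable_eq_min_max_Fk
    {n Mc : ℕ} {QA X0A YdA : Type} {XA YA YhA : Fin n → Type}
    [Fintype QA] [DecidableEq QA] [Fintype X0A] [DecidableEq X0A]
    [Fintype YdA] [DecidableEq YdA]
    [∀ i, Fintype (XA i)] [∀ i, DecidableEq (XA i)]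
    [∀ i, Fintype (YA i)] [∀ i, DecidableEq (YA i)]
    [∀ i, Fintype (YhA i)] [∀ i, DecidableEq (YhA i)]
    (ℳ : Finset (Fin n)) (hMcard : ℳ.card = Mc)
    (σ : Fin Mc → Fin n) (hσinj : Function.Injective σ)
    (hσmem : ∀ j, σ j ∈ ℳ) (hσsurj : ∀ i ∈ ℳ, ∃ j, σ j = i)
    (pQ : QA → ℝ) (p0 : QA → X0A → ℝ)
    (pM : QA → X0A → (∀ i : ℳ, XA i) → ℝ) (pC : ∀ i : Fin n, QA → XA i → ℝ)
    (W : X0A → (∀ i, XA i) → ((∀ i, YA i) × YdA) → ℝ)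
    (κ : ∀ i : Fin n, QA → YA i → XA i → YhA i → ℝ)
    (hpQ : ∀ q, 0 ≤ pQ q) (hpQs : ∑ q, pQ q = 1)
    (hp0 : ∀ q x, 0 ≤ p0 q x) (hp0s : ∀ q, ∑ x, p0 q x = 1)
    (hpM : ∀ q x0 xm, 0 ≤ pM q x0 xm) (hpMs : ∀ q x0, ∑ xm, pM q x0 xm = 1)
    (hpC : ∀ i q x, 0 ≤ pC i q x) (hpCs : ∀ i q, ∑ x, pC i q x = 1)
    (hW : ∀ x0 x y, 0 ≤ W x0 x y) (hWs : ∀ x0 x, ∑ y, W x0 x y = 1)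
    (hκ : ∀ i q y x yh, 0 ≤ κ i q y x yh) (hκs : ∀ i q y x, ∑ yh, κ i q y x yh = 1)
    (D : Fin (Mc + 1) → Finset (Fin n))
    (hDsub : ∀ k, D k ⊆ ℳᶜ)
    (hDdec : ∀ k, SelfDecodable ℳ σ (muDF ℳ pQ p0 pM pC W κ) k (D k))
    (hDmax : ∀ k, ∀ E ⊆ ℳᶜ,
      SelfDecodable ℳ σ (muDF ℳ pQ p0 pM pC W κ) k E → E ⊆ D k) :
    (Finset.univ : Finset (Fin (Mc + 1))).inf' Finset.univ_nonempty
        (fun k => Fk ℳ σ (muDF ℳ pQ p0 pM pC W κ) k (D k)) =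
      (Finset.univ : Finset (Fin (Mc + 1))).inf' Finset.univ_nonempty
        (fun k => ℳᶜ.powerset.sup' (Finset.powerset_nonempty _)
          (Fk ℳ σ (muDF ℳ pQ p0 pM pC W κ) k)) := by
  set μ := muDF ℳ pQ p0 pM pC W κ
  have hμ : ∀ ω, 0 ≤ μ ω := muDF_nonneg hpQ hp0 hpM hpC hW hκ
  let c : Fin n → ℝ := fun i => ∑ ω, μ ω *
    -Real.log (κ i ω.1 (ω.2.2.2.1 i) (ω.2.2.1 i) (ω.2.2.2.2.2 i))
  refine Finset.inf'_congr _ rfl fun k _ => ?_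
  have hU := upSet_union_downSet hσmem hσsurj k
  have hc : ∀ T, ∀ S ⊆ T, entropy μ (fun ω => (rvYhS S ω, rvYS S ω,
        ((rvX0 ω, rvXS ℳ ω), rvXS T ω, rvYk σ k ω, rvYhS (T \ S) ω, rvQ ω))) =
      entropy μ (fun ω => (rvYS S ω,
        ((rvX0 ω, rvXS ℳ ω), rvXS T ω, rvYk σ k ω, rvYhS (T \ S) ω, rvQ ω))) +
        ∑ i ∈ S, c i := by
    intro T S hST
    refine entropy_rvYhS_pair hμ hκs _ ?_ ?_
    · intro q x0 x y yd yh i hi a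
      have hYh : rvYhS (T \ S) (q, x0, x, y, yd, Function.update yh i a) =
          rvYhS (T \ S) (q, x0, x, y, yd, yh) := by
        rw [rvYhS_eq_iff]
        intro j hj
        refine Function.update_of_ne ?_ _ _
        rintro rfl
        exact (Finset.mem_sdiff.1 hj).2 hi
      exact congrArg (fun v => (rvYS S (q, x0, x, y, yd, yh), ((x0, rvXS ℳ (q, x0, x, y, yd, yh)),
        rvXS T (q, x0, x, y, yd, yh), rvYk σ k (q, x0, x, y, yd, yh), v, q))) hYh
    · intro ω ω' h
      simp only [Prod.mk.injEq] at h
      exact ⟨h.2.2.2.2.2, h.1, rvXS_eq_of_subset hST h.2.2.1⟩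
  have hd := fun T (hT : T ⊆ ℳᶜ) => entropy_rvXS_pair (W := W) (κ := κ) hpQ hp0 hpM hpC hpCs hWs
    hκs (fun ω => ((fun i : downSet σ k => ω.2.2 i : ∀ i : downSet σ k, XA i), ω.1))
    (fun ω ω' h => (Prod.ext_iff.1 h).2)
    (fun q x0 x x' h => Prod.ext (funext fun i => h i (hU ▸ Finset.mem_union_right _ i.2)) rfl) hT
  have hd' := fun T (hT : T ⊆ ℳᶜ) => entropy_rvXS_pair (W := W) (κ := κ) hpQ hp0 hpM hpC hpCs hWs
    hκs (fun ω => ((ω.2.1, (fun i : ℳ => ω.2.2 i : ∀ i : ℳ, XA i)), ω.1))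
    (fun ω ω' h => (Prod.ext_iff.1 h).2)
    (fun q x0 x x' h => Prod.ext (Prod.ext rfl (funext fun i => h i i.2)) rfl) hT
  have hself : ∀ E, SelfDecodable ℳ σ μ k E ↔ ∀ S ⊆ E, S.Nonempty →
      0 < outputPotential σ μ c k (fun ω => ((rvX0 ω, rvXS ℳ ω), rvQ ω)) (E \ S)
        - outputPotential σ μ c k (fun ω => ((rvX0 ω, rvXS ℳ ω), rvQ ω)) E := fun E =>
    forall₂_congr fun S hS => by
      rw [condMI_selfDecode_sub_condMI_quantization hS (hc E S hS)]
  refine inf'_largest_eq_sup'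
    (φ := outputPotential σ μ c k fun ω => (rvXS (downSet σ k) ω, rvQ ω))
    (ψ := outputPotential σ μ c k fun ω => ((rvX0 ω, rvXS ℳ ω), rvQ ω))
    (fun T _ => ?_) (fun A hA B hB => outputPotential_submodular hμ hd' hA hB)
    (fun B hB A hAB => outputPotential_sub_mono hμ (fun ω ω' h => ?_) hd hd' hB hAB)
    (hDsub k) ((hself _).1 (hDdec k)) (fun E hE h => hDmax k E hE ((hself E).2 h))
  · refine Finset.inf'_congr _ rfl fun S hS => ?_
    have hST := Finset.mem_powerset.1 hS
    exact condMI_decode_sub_condMI_quantization hU hST (hc T S hST)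
  · simp only [Prod.mk.injEq] at h ⊢
    exact ⟨rvXS_eq_of_subset (hU ▸ Finset.subset_union_right) h.1.2, h.2⟩
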